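/- arXiv:1512.07537 — 2 statements merged into one kernel-verified Lean document; each statement's English description precedes it below -/
import Mathlib

section
/- Let y_1, …, y_n ∈ ℝ with weights w_1, …, w_n > 0, let a < b be anchors, and let m ∈ {0,…,n} be a split with C(m, b) = C*(b) that is maximal, i.e., C(m', b) > C(m, b) for every m' > m. Suppose max_{i≤m} w_i·|a − y_i| < max_{i>m} w_i·|b − y_i|, and there exists an index i > m with y_i < b whose cost achieves the right-side maximum, i.e., w_i·(b − y_i) = max_{i'>m} w_{i'}·|b − y_{i'}|. Then the optimal right anchor cannot lie above b: for every b' > b, C*(b') ≥ C*(b). -/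
/-- Maximum of a real-valued function over a finite set, with the maximum
over the empty set being `0`. -/
noncomputable def fmax {ι : Type*} (s : Finset ι) (f : ι → ℝ) : ℝ :=
  if h : s.Nonempty then s.sup' h f else 0

/-- Cost of the left block `{1, …, m}` with the left anchor `a`:
`max_{i ≤ m} w i * |a - y i|` (points are indexed by `Fin n`, point `i`
being the `(i+1)`-st point). -/
noncomputable def leftCost (n : ℕ) (y w : Fin n → ℝ) (a : ℝ) (m : ℕ) : ℝ :=
  fmax (Finset.univ.filter fun i : Fin n => (i : ℕ) < m)
    fun i => w i * |a - y i|

/-- Cost of the right block `{m+1, …, n}` with the right anchor `b`: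
`max_{i > m} w i * |b - y i|`. -/
noncomputable def rightCost (n : ℕ) (y w : Fin n → ℝ) (b : ℝ) (m : ℕ) : ℝ :=
  fmax (Finset.univ.filter fun i : Fin n => m ≤ (i : ℕ))
    fun i => w i * |b - y i|

/-- The doubly anchored 2-step cost of the split `m ∈ {0, …, n}` with left
anchor `a` and right anchor `b`. -/
noncomputable def anchCost (n : ℕ) (y w : Fin n → ℝ) (a b : ℝ) (m : ℕ) : ℝ :=
  max (leftCost n y w a m) (rightCost n y w b m)

/-- The optimal doubly anchored 2-step cost `C*(b) = min_{0 ≤ m ≤ n} C(m, b)`. -/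
noncomputable def anchOpt (n : ℕ) (y w : Fin n → ℝ) (a b : ℝ) : ℝ :=
  (Finset.range (n + 1)).inf' ⟨0, Finset.mem_range.mpr n.succ_pos⟩
    (anchCost n y w a b)

theorem le_fmax {ι : Type*} {s : Finset ι} {i : ι} (f : ι → ℝ) (hi : i ∈ s) :
    f i ≤ fmax s f := by
  rw [fmax, dif_pos ⟨i, hi⟩]
  exact Finset.le_sup' f hi

theorem fmax_le {ι : Type*} {s : Finset ι} {f : ι → ℝ} {c : ℝ} (hc : 0 ≤ c)
    (h : ∀ i ∈ s, f i ≤ c) : fmax s f ≤ c := by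
  unfold fmax
  split_ifs with hs
  · exact Finset.sup'_le hs f h
  · exact hc

theorem le_rightCost {n : ℕ} (y w : Fin n → ℝ) (b : ℝ) {m : ℕ} {i : Fin n}
    (hi : m ≤ (i : ℕ)) : w i * |b - y i| ≤ rightCost n y w b m :=
  le_fmax (fun i => w i * |b - y i|) (by simpa using hi)

theorem rightCost_antitone {n : ℕ} (y : Fin n → ℝ) {w : Fin n → ℝ} (hw : ∀ i, 0 ≤ w i)
    (b : ℝ) : Antitone (rightCost n y w b) := by
  intro m m' hm
  have hnonneg : 0 ≤ rightCost n y w b m := by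
    unfold rightCost fmax
    split_ifs with hs
    · obtain ⟨i, hi⟩ := hs
      exact (mul_nonneg (hw i) (abs_nonneg (b - y i))).trans
        (Finset.le_sup' (fun i => w i * |b - y i|) hi)
    · exact le_rfl
  refine fmax_le hnonneg fun i hi => le_rightCost y w b (hm.trans ?_)
  simpa using hi

/-- If an optimal, maximal split `m` for right anchor `b` has left cost
strictly smaller than the right cost, and some critical point of the right
block lies below `b`, then the optimal right anchor cannot lie above `b`. -/
theorem right_anchor_not_above_of_crit_below (n : ℕ) (y w : Fin n → ℝ)
    (hw : ∀ i, 0 < w i) (a b : ℝ) (hab : a < b) (m : ℕ) (hmn : m ≤ n)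
    (hopt : anchCost n y w a b m = anchOpt n y w a b)
    (hmaximal : ∀ m', m < m' → m' ≤ n →
      anchCost n y w a b m < anchCost n y w a b m')
    (hlt : leftCost n y w a m < rightCost n y w b m)
    (hcrit : ∃ i : Fin n, m ≤ (i : ℕ) ∧ y i < b ∧
      w i * (b - y i) = rightCost n y w b m) :
    ∀ b' > b, anchOpt n y w a b ≤ anchOpt n y w a b' := by
  intro b' hb'
  obtain ⟨i, hmi, hyi, hi⟩ := hcrit
  have hcost : anchCost n y w a b m = rightCost n y w b m := max_eq_right hlt.le
  rw [← hopt]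
  refine Finset.le_inf' _ _ fun k hk => ?_
  rcases le_or_gt k m with hkm | hmk
  · rw [hcost, ← hi]
    calc w i * (b - y i) ≤ w i * |b' - y i| :=
          mul_le_mul_of_nonneg_left ((sub_le_sub_right hb'.le _).trans (le_abs_self _)) (hw i).le
      _ ≤ rightCost n y w b' k := le_rightCost y w b' (hkm.trans hmi)
      _ ≤ anchCost n y w a b' k := le_max_right _ _
  · have hlarge := hmaximal k hmk (Nat.lt_succ_iff.mp (Finset.mem_range.mp hk))
    have hright := rightCost_antitone y (fun i => (hw i).le) b hmk.le
    rw [← hcost] at hright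
    exact ((lt_max_iff.mp hlarge).resolve_right hright.not_gt).le.trans (le_max_left _ _)
end

section
/- Let y_1, …, y_n ∈ ℝ with weights w_1, …, w_n > 0, let a ∈ ℝ be a left anchor, and let m ∈ {0,…,n} be a split such that max_{i≤m} w_i·|a − y_i| = r({m+1,…,n}). Then the split m is optimal for the left-anchored 2-step problem: LA(a) = E(m) = max_{i≤m} w_i·|a − y_i|. -/
/-- The 1-center radius of the suffix `{m+1, …, n}`:
`inf_t max_{i > m} w i * |t - y i|`. -/
noncomputable def suffixRadius (n : ℕ) (y w : Fin n → ℝ) (m : ℕ) : ℝ :=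
  ⨅ t : ℝ, fmax (Finset.univ.filter fun i : Fin n => m ≤ (i : ℕ))
    fun i => w i * |t - y i|

/-- The left-anchored 2-step cost of the split `m ∈ {0, …, n}`:
`E(m) = max( max_{i ≤ m} w i * |a - y i|, r({m+1, …, n}) )`. -/
noncomputable def laCost (n : ℕ) (y w : Fin n → ℝ) (a : ℝ) (m : ℕ) : ℝ :=
  max (leftCost n y w a m) (suffixRadius n y w m)

/-- The optimal left-anchored 2-step cost `LA(a) = min_{0 ≤ m ≤ n} E(m)`. -/
noncomputable def laOpt (n : ℕ) (y w : Fin n → ℝ) (a : ℝ) : ℝ :=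
  (Finset.range (n + 1)).inf' ⟨0, Finset.mem_range.mpr n.succ_pos⟩
    (laCost n y w a)

theorem fmax_nonneg {ι : Type*} (s : Finset ι) (f : ι → ℝ) (hf : ∀ i, 0 ≤ f i) :
    0 ≤ fmax s f := by
  unfold fmax
  split_ifs with h
  · obtain ⟨i, hi⟩ := h
    exact (hf i).trans (Finset.le_sup' f hi)
  · exact le_rfl

theorem fmax_mono {ι : Type*} {s t : Finset ι} (hst : s ⊆ t) (f : ι → ℝ)
    (hf : ∀ i, 0 ≤ f i) : fmax s f ≤ fmax t f := by
  by_cases h : s.Nonempty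
  · rw [fmax, fmax, dif_pos h, dif_pos (h.mono hst)]
    exact Finset.sup'_mono f hst h
  · rw [fmax, dif_neg h]
    exact fmax_nonneg t f hf

theorem leftCost_monotone (n : ℕ) (y w : Fin n → ℝ) (hw : ∀ i, 0 < w i) (a : ℝ) :
    Monotone (leftCost n y w a) := fun _ _ hkl =>
  fmax_mono (Finset.monotone_filter_right _ fun _ _ hi => lt_of_lt_of_le hi hkl) _
    fun i => mul_nonneg (hw i).le (abs_nonneg _)

theorem suffixRadius_antitone (n : ℕ) (y w : Fin n → ℝ) (hw : ∀ i, 0 < w i) :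
    Antitone (suffixRadius n y w) := fun _ _ hkl =>
  have hcost (t : ℝ) (i : Fin n) : 0 ≤ w i * |t - y i| :=
    mul_nonneg (hw i).le (abs_nonneg _)
  ciInf_mono ⟨0, Set.forall_mem_range.mpr fun t => fmax_nonneg _ _ (hcost t)⟩ fun t =>
    fmax_mono (Finset.monotone_filter_right _ fun _ _ hi => le_trans hkl hi) _ (hcost t)

/-- If at split `m` the left cost equals the 1-center radius of the suffix,
then `m` is an optimal split for the left-anchored 2-step problem. -/
theorem la_split_optimal_of_eq (n : ℕ) (y w : Fin n → ℝ) (hw : ∀ i, 0 < w i)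
    (a : ℝ) (m : ℕ) (hmn : m ≤ n)
    (heq : leftCost n y w a m = suffixRadius n y w m) :
    laOpt n y w a = laCost n y w a m ∧
      laCost n y w a m = leftCost n y w a m := by
  have hcost : laCost n y w a m = leftCost n y w a m := by
    rw [laCost, ← heq, max_self]
  refine ⟨le_antisymm (Finset.inf'_le _ (Finset.mem_range.mpr (Nat.lt_succ_of_le hmn))) ?_, hcost⟩
  refine Finset.le_inf' _ _ fun k _ => ?_
  rw [hcost]
  rcases le_total m k with h | h
  · exact (leftCost_monotone n y w hw a h).trans (le_max_left _ _)
  · exact heq.le.trans ((suffixRadius_antitone n y w hw h).trans (le_max_right _ _))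
end
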